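/- There are no integers t ≥ 2 and a ≥ 0 satisfying (2t³ + 2t² + t - 1 - 2a)(2t³ + 2t² + t - 1 + 2a) = 5t² + 6t + 1. -/

import Mathlib

theorem stmt_7 : ¬ ∃ t a : ℤ, 2 ≤ t ∧ 0 ≤ a ∧
    (2 * t ^ 3 + 2 * t ^ 2 + t - 1 - 2 * a) * (2 * t ^ 3 + 2 * t ^ 2 + t - 1 + 2 * a) =
      5 * t ^ 2 + 6 * t + 1 := by
  rintro ⟨t, a, ht, ha, h⟩
  have h2 : 0 ≤ t ^ 2 := sq_nonneg t
  have h3 : 0 ≤ t ^ 3 := by positivity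
  have hv : 0 < 2 * t ^ 3 + 2 * t ^ 2 + t - 1 + 2 * a := by linarith
  have hu : 0 < 2 * t ^ 3 + 2 * t ^ 2 + t - 1 - 2 * a := by
    refine pos_of_mul_pos_left ?_ hv.le
    rw [h]; linarith
  have key := mul_nonneg (sub_nonneg.mpr (Int.add_one_le_iff.mpr hu))
    (sub_nonneg.mpr (Int.add_one_le_iff.mpr hv))
  obtain ⟨s, rfl⟩ : ∃ s, t = s + 2 := ⟨t - 2, by ring⟩
  have hs : 0 ≤ s := by linarith
  have hs2 : 0 ≤ s ^ 2 := by positivity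
  have hs3 : 0 ≤ s ^ 3 := by positivity
  nlinarith
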